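/- arXiv:2310.11704 — 2 statements merged into one kernel-verified Lean document; each statement's English description precedes it below -/
import Mathlib

section
/- Let m ≥ 4 be an integer and let G be the graph obtained from the path P_m = u₁u₂⋯u_m by adding the two edges u₁u₃ and u₂u₄ (so the first four vertices induce K₄ minus the edge u₁u₄, with the path u₄u₅⋯u_m attached at u₄). Then for every connected simple graph H of order n, p(G □ H) ≤ mn/2. -/
open SimpleGraph

/-- `P` is a path decomposition of `G`: a list of edge-disjoint paths of `G`
covering all the edges of `G`. -/
def SimpleGraph.IsPathDecomp {V : Type*} (G : SimpleGraph V)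
    (P : List (Σ u v : V, G.Walk u v)) : Prop :=
  (∀ p ∈ P, p.2.2.IsPath) ∧
  P.Pairwise (fun p q => ∀ e ∈ p.2.2.edges, e ∉ q.2.2.edges) ∧
  ∀ e ∈ G.edgeSet, ∃ p ∈ P, e ∈ p.2.2.edges

/-- `p(G)`: the minimum number of paths in a path decomposition of `G`. -/
noncomputable def SimpleGraph.pathNumber {V : Type*} (G : SimpleGraph V) : ℕ :=
  sInf {k | ∃ P, G.IsPathDecomp P ∧ P.length = k}

section Lists
variable {V : Type*}

/-- The multiset of edges joining consecutive vertices of a list. -/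
def pathEdges : List V → Multiset (Sym2 V)
  | [] => 0
  | [_] => 0
  | a :: b :: l => s(a, b) ::ₘ pathEdges (b :: l)

/-- The multiset consisting of the first and the last vertex of a list. -/
def pathEnds (L : List V) : Multiset V :=
  (L.head?.toList : Multiset V) + (L.getLast?.toList : Multiset V)

theorem pathEdges_append (l₁ : List V) (a : V) (l₂ : List V) :
    pathEdges (l₁ ++ a :: l₂) = pathEdges (l₁ ++ [a]) + pathEdges (a :: l₂) := by
  induction l₁ with
  | nil => simp [pathEdges]
  | cons x l ih =>
    cases l with
    | nil => simp [pathEdges]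
    | cons y l => simpa [pathEdges] using ih

theorem pathEdges_append_append (l₁ : List V) (a b : V) (l₂ : List V) :
    pathEdges (l₁ ++ a :: b :: l₂) =
      s(a, b) ::ₘ (pathEdges (l₁ ++ [a]) + pathEdges (b :: l₂)) := by
  rw [pathEdges_append]; simp [pathEdges]

theorem pathEdges_reverse (L : List V) : pathEdges L.reverse = pathEdges L := by
  induction L with
  | nil => rfl
  | cons a l ih =>
    cases l with
    | nil => rfl
    | cons b l =>
      have := pathEdges_append_append l.reverse b a []
      simp only [List.reverse_cons, List.append_assoc, List.cons_append, List.nil_append] at ih ⊢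
      rw [this, ih]
      simp [pathEdges, Sym2.eq_swap]

theorem pathEnds_reverse (L : List V) : pathEnds L.reverse = pathEnds L := by
  simp [pathEnds, add_comm]

theorem card_pathEnds {L : List V} (h : L ≠ []) : (pathEnds L).card = 2 := by
  obtain ⟨a, l, rfl⟩ := List.exists_cons_of_ne_nil h
  simp [pathEnds, List.getLast?_cons]

theorem exists_orient {L : List V} {x : V} (h : x ∈ pathEnds L) :
    L.head? = some x ∨ L.reverse.head? = some x := by
  simpa [pathEnds, Option.mem_toList, eq_comm] using h

theorem sum_update_add {N : ℕ} {A M : Type*} [AddCommMonoid M] (f : A → M) (D : Fin N → A)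
    (i : Fin N) (L : A) :
    ∑ j, f (Function.update D i L j) + f (D i) = ∑ j, f (D j) + f L := by
  rw [← Finset.add_sum_erase Finset.univ (fun j => f (D j)) (Finset.mem_univ i),
    ← Finset.add_sum_erase Finset.univ (fun j => f (Function.update D i L j)) (Finset.mem_univ i)]
  have : ∑ j ∈ Finset.univ.erase i, f (Function.update D i L j)
      = ∑ j ∈ Finset.univ.erase i, f (D j) :=
    Finset.sum_congr rfl fun j hj => by
      rw [Function.update_of_ne (Finset.ne_of_mem_erase hj)]
  rw [this, Function.update_self]
  ac_rfl

theorem exists_reroute [DecidableEq V] {N : ℕ} (c : V) (n : ℕ) : ∀ (D : Fin N → List V) (b : V)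
    (τ : Multiset V), (∑ i, pathEdges (D i)).card < n → (∀ i, (D i).Nodup) →
    (∑ i, pathEdges (D i)).Nodup → ∑ i, pathEnds (D i) = b ::ₘ τ → b ≠ c →
    (∀ v, s(c, v) ∈ ∑ i, pathEdges (D i) → v ∈ τ) →
    ∃ D' : Fin N → List V, (∀ i, (D' i).Nodup) ∧
      ∑ i, pathEdges (D' i) = s(c, b) ::ₘ ∑ i, pathEdges (D i) ∧
      ∑ i, pathEnds (D' i) = c ::ₘ τ ∧
      ∀ i, c ∈ D i → (D' i).Perm (D i) ∧ ((D i).head? = some c → (D' i).head? = some c) := by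
  induction n with
  | zero => intro D b τ h; simp at h
  | succ n ih =>
    intro D b τ hn hD hE hT hbc hc
    obtain ⟨i, -, hi⟩ : ∃ i ∈ Finset.univ, b ∈ pathEnds (D i) := by
      rw [← Multiset.mem_sum, hT]; simp
    obtain ⟨L, hL, hLD⟩ : ∃ L : List V, L.head? = some b ∧ (L = D i ∨ L = (D i).reverse) := by
      rcases exists_orient hi with h | h
      · exact ⟨_, h, .inl rfl⟩
      · exact ⟨_, h, .inr rfl⟩
    have hLE : pathEdges (D i) = pathEdges L := by
      rcases hLD with rfl | rfl <;> simp [pathEdges_reverse]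
    have hLT : pathEnds (D i) = pathEnds L := by
      rcases hLD with rfl | rfl <;> simp [pathEnds_reverse]
    have hLP : L.Perm (D i) := by
      rcases hLD with rfl | rfl
      · exact .refl _
      · exact List.reverse_perm _
    have hLN : L.Nodup := hLP.nodup_iff.2 (hD i)
    by_cases hcL : c ∈ L
    · obtain ⟨p', q, rfl⟩ := List.append_of_mem hcL
      obtain rfl | ⟨p, y, rfl⟩ := List.eq_nil_or_concat' p'
      · simp at hL; exact absurd hL.symm hbc
      have hEL : pathEdges (p ++ [y] ++ c :: q) =
          s(y, c) ::ₘ (pathEdges (p ++ [y]) + pathEdges (c :: q)) := by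
        rw [← pathEdges_append_append]; simp
      have hTL : pathEnds (p ++ [y] ++ c :: q) + {c} = {b} + pathEnds (c :: q) := by
        rw [pathEnds, hL, pathEnds, List.getLast?_append_of_ne_nil _ (by simp)]
        simp [-Multiset.singleton_add]
        ac_rfl
      have hE1 := sum_update_add pathEdges D i (c :: q)
      have hT1 := sum_update_add pathEnds D i (c :: q)
      rw [hLE, hEL] at hE1
      rw [hLT, hT] at hT1
      set D₁ := Function.update D i (c :: q) with hD₁
      have hE2 : ∑ j, pathEdges (D j) =
          s(c, y) ::ₘ (pathEdges (p ++ [y]) + ∑ j, pathEdges (D₁ j)) := by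
        rw [Sym2.eq_swap]
        apply add_right_cancel (b := pathEdges (c :: q))
        rw [← hE1]
        simp only [← Multiset.singleton_add]
        ac_rfl
      have hyτ : y ∈ τ := hc y (by rw [hE2]; simp)
      have hT2 : ∑ j, pathEnds (D₁ j) = c ::ₘ τ := by
        apply add_right_cancel (b := pathEnds (p ++ [y] ++ c :: q) + {c})
        rw [← add_assoc, hT1, hTL]
        simp only [← Multiset.singleton_add]
        ac_rfl
      have hyc : y ≠ c := by
        rintro rfl; simp [List.nodup_append] at hLN
      obtain ⟨D₂, hD2, hE3, hT3, hP⟩ := ih D₁ y (c ::ₘ τ.erase y)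
        (by rw [hE2] at hn; simp only [Multiset.card_cons, Multiset.card_add] at hn; omega)
        (by
          intro j
          by_cases hj : j = i
          · subst hj; simp only [hD₁, Function.update_self]
            exact (List.nodup_append.1 hLN).2.1
          · simp only [hD₁, Function.update_of_ne hj]; exact hD j)
        (by
          rw [hE2, Multiset.nodup_cons, Multiset.nodup_add] at hE
          exact hE.2.2.1)
        (by rw [hT2, Multiset.cons_swap, Multiset.cons_erase hyτ]) hyc
        (by
          intro v hv
          refine Multiset.mem_cons_of_mem ?_
          have : v ≠ y := by
            rintro rfl
            rw [hE2, Multiset.nodup_cons] at hE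
            exact hE.1 (Multiset.mem_add.2 (.inr hv))
          rw [Multiset.mem_erase_of_ne this]
          exact hc v (by rw [hE2]; simp [hv]))
      obtain ⟨hP1, hP2⟩ := hP i (by simp [hD₁])
      simp only [hD₁, Function.update_self] at hP1 hP2
      have hP2 := hP2 rfl
      obtain ⟨q', hq'⟩ : ∃ q', D₂ i = c :: q' := by
        cases h : D₂ i with
        | nil => simp [h] at hP2
        | cons a l => simp [h] at hP2; exact ⟨l, by rw [hP2]⟩
      have hpb : ∃ p₁, p ++ [y] = b :: p₁ := by
        cases p with
        | nil => simp at hL; exact ⟨[], by simp [hL]⟩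
        | cons a l => simp at hL; exact ⟨l ++ [y], by simp [hL]⟩
      obtain ⟨p₁, hp₁⟩ := hpb
      have hME : pathEdges ((p ++ [y]).reverse ++ D₂ i) =
          s(c, b) ::ₘ (pathEdges (p ++ [y]) + pathEdges (D₂ i)) := by
        rw [hq', ← pathEdges_reverse (p ++ [y]), hp₁]
        simp only [List.reverse_cons, List.append_assoc, List.cons_append, List.nil_append]
        rw [pathEdges_append_append, Sym2.eq_swap]
      have hMT : pathEnds ((p ++ [y]).reverse ++ D₂ i) + {c} = {y} + pathEnds (D₂ i) := by
        rw [hq', pathEnds, pathEnds, List.getLast?_append_of_ne_nil _ (by simp)]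
        simp [-Multiset.singleton_add]
        ac_rfl
      have hMP : ((p ++ [y]).reverse ++ D₂ i).Perm (p ++ [y] ++ c :: q) :=
        (List.reverse_perm _).append hP1
      obtain ⟨M, hM1, hM2, hM3, hM4⟩ : ∃ M : List V,
          pathEdges M = pathEdges ((p ++ [y]).reverse ++ D₂ i) ∧
          pathEnds M = pathEnds ((p ++ [y]).reverse ++ D₂ i) ∧
          M.Perm ((p ++ [y]).reverse ++ D₂ i) ∧ ((D i).head? = some c → M.head? = some c) := by
        rcases hLD with h | h
        · refine ⟨_, rfl, rfl, .refl _, fun h' => ?_⟩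
          rw [← h, hL] at h'
          exact absurd (Option.some.inj h') hbc
        · refine ⟨_, pathEdges_reverse _, pathEnds_reverse _, List.reverse_perm _, fun h' => ?_⟩
          have hq : (p ++ [y] ++ c :: q).getLast? = some c := by
            rw [h, List.getLast?_reverse, h']
          have : q = [] := by
            rw [List.getLast?_append_of_ne_nil _ (by simp)] at hq
            by_contra hne
            have h3 : c ∈ q := by
              obtain ⟨a, l, rfl⟩ := List.exists_cons_of_ne_nil hne
              rw [List.getLast?_cons_cons] at hq
              exact List.mem_of_getLast? hq
            have := (List.nodup_append.1 hLN).2.1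
            simp [h3] at this
          subst this
          rw [List.perm_singleton] at hP1
          simp [hP1]
      refine ⟨Function.update D₂ i M, ?_, ?_, ?_, ?_⟩
      · intro j
        by_cases hj : j = i
        · subst hj; simp only [Function.update_self]
          exact (hM3.trans hMP).nodup_iff.2 hLN
        · simp only [Function.update_of_ne hj]; exact hD2 j
      · have := sum_update_add pathEdges D₂ i M
        rw [hM1, hME, hE3] at this
        apply add_right_cancel (b := pathEdges (D₂ i))
        rw [this, hE2]
        simp only [← Multiset.singleton_add]
        ac_rfl
      · have := sum_update_add pathEnds D₂ i M
        rw [hM2, hT3] at this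
        apply add_right_cancel (b := pathEnds (D₂ i) + {c} + {y})
        calc _ = (∑ j, pathEnds (Function.update D₂ i M j) + pathEnds (D₂ i)) + {c} + {y} := by
              ac_rfl
          _ = (c ::ₘ c ::ₘ τ.erase y) + (pathEnds ((p ++ [y]).reverse ++ D₂ i) + {c}) + {y} := by
              rw [this]; ac_rfl
          _ = (c ::ₘ c ::ₘ (y ::ₘ τ.erase y)) + (pathEnds (D₂ i)) + {y} := by
              rw [hMT]
              simp only [← Multiset.singleton_add]
              ac_rfl
          _ = _ := by
              rw [Multiset.cons_erase hyτ]
              simp only [← Multiset.singleton_add]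
              ac_rfl
      · intro j hj
        by_cases hji : j = i
        · subst hji
          simp only [Function.update_self]
          exact ⟨(hM3.trans hMP).trans hLP, hM4⟩
        · simp only [Function.update_of_ne hji]
          have := hP j
          simp only [hD₁, Function.update_of_ne hji] at this
          exact this hj
    · obtain ⟨l, rfl⟩ : ∃ l, L = b :: l := by
        cases L with
        | nil => simp at hL
        | cons a l => simp at hL; exact ⟨l, by rw [hL]⟩
      refine ⟨Function.update D i (c :: b :: l), ?_, ?_, ?_, ?_⟩
      · intro j
        by_cases hj : j = i
        · subst hj; simp only [Function.update_self]; exact List.nodup_cons.2 ⟨hcL, hLN⟩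
        · simp only [Function.update_of_ne hj]; exact hD j
      · have := sum_update_add pathEdges D i (c :: b :: l)
        rw [hLE] at this
        apply add_right_cancel (b := pathEdges (b :: l))
        rw [this, pathEdges]
        simp only [← Multiset.singleton_add]
        ac_rfl
      · have := sum_update_add pathEnds D i (c :: b :: l)
        rw [hLT, hT] at this
        apply add_right_cancel (b := pathEnds (b :: l))
        rw [this]
        simp [pathEnds, ← Multiset.singleton_add]
        ac_rfl
      · intro j hj
        have : j ≠ i := by rintro rfl; exact hcL (hLP.mem_iff.2 hj)
        simp only [Function.update_of_ne this]
        exact ⟨.refl _, id⟩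
end Lists

section Solve
variable {V : Type*} [DecidableEq V]

/-- The edges of `𝓔` decompose into paths (trivial ones allowed) such that each vertex `v` is an
end of a path exactly `t v` times. -/
def Solvable (𝓔 : Finset (Sym2 V)) (t : V → ℕ) : Prop :=
  ∃ (N : ℕ) (D : Fin N → List V), (∀ i, (D i).Nodup) ∧ ∑ i, pathEdges (D i) = 𝓔.val ∧
    ∀ v, (∑ i, pathEnds (D i)).count v = t v

theorem Solvable.insert_edge {𝓔 : Finset (Sym2 V)} {t t' : V → ℕ} {b c : V}
    (h : Solvable 𝓔 t') (hbc : b ≠ c) (he : s(c, b) ∉ 𝓔) (hc : ∀ v, s(c, v) ∈ 𝓔 → 1 ≤ t' v)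
    (hb : 1 ≤ t' b)
    (ht : ∀ v, t v + (if v = b then 1 else 0) = t' v + (if v = c then 1 else 0)) :
    Solvable (insert s(c, b) 𝓔) t := by
  obtain ⟨N, D, hD, hE, hT⟩ := h
  have hbT : b ∈ ∑ i, pathEnds (D i) := by
    rw [← Multiset.one_le_count_iff_mem, hT]; exact hb
  obtain ⟨τ, hτ⟩ := Multiset.exists_cons_of_mem hbT
  obtain ⟨D', hD', hE', hT', -⟩ := exists_reroute c _ D b τ (Nat.lt_succ_self _) hD
    (by rw [hE]; exact 𝓔.nodup) hτ hbc (by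
      intro v hv
      rw [hE] at hv
      have hv' : v ≠ b := by rintro rfl; exact he hv
      have := hc v hv
      rw [← hT, Multiset.one_le_count_iff_mem, hτ] at this
      exact (Multiset.mem_cons.1 this).resolve_left hv')
  refine ⟨N, D', hD', by rw [hE', hE, Finset.insert_val_of_notMem he], fun v => ?_⟩
  have h1 := hT v
  have h2 := ht v
  rw [hτ, Multiset.count_cons] at h1
  rw [hT', Multiset.count_cons]
  omega

theorem solvable_of_even [Fintype V] (n : ℕ) : ∀ (𝓔 : Finset (Sym2 V)) (t : V → ℕ), 𝓔.card = n →
    (∀ e ∈ 𝓔, ¬ e.IsDiag) → (∀ v, Even (t v + (𝓔.filter (v ∈ ·)).card)) →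
    (∀ u v, t u = 0 → t v = 0 → (∃ e ∈ 𝓔, u ∈ e) → (∃ e ∈ 𝓔, v ∈ e) → u = v) →
    Solvable 𝓔 t := by
  induction n with
  | zero =>
    intro 𝓔 t hn _ ht _
    obtain rfl := Finset.card_eq_zero.1 hn
    let e := (Fintype.equivFin (Σ v, Fin (t v / 2))).symm
    refine ⟨_, fun i => [(e i).1], by simp, by simp [pathEdges], fun v => ?_⟩
    rw [e.sum_comp (fun x : Σ v, Fin (t v / 2) => pathEnds [x.1])]
    rw [Multiset.count_sum', Fintype.sum_sigma]
    have := ht v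
    simp only [Finset.filter_empty, Finset.card_empty, add_zero] at this
    obtain ⟨k, hk⟩ := this
    simp [pathEnds, Multiset.count_singleton, Multiset.count_cons, mul_add, Finset.sum_add_distrib]
    omega
  | succ n ih =>
    intro 𝓔 t hn hd ht hz
    obtain ⟨c, b, hcb, hcb'⟩ : ∃ c b, s(c, b) ∈ 𝓔 ∧
        ∀ v, t v = 0 → (∃ e ∈ 𝓔, v ∈ e) → v = b := by
      by_cases h : ∃ b, t b = 0 ∧ ∃ e ∈ 𝓔, b ∈ e
      · obtain ⟨b, hb, e, he, hbe⟩ := h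
        obtain ⟨c, rfl⟩ := Sym2.mem_iff_exists.1 hbe
        exact ⟨c, b, by rwa [Sym2.eq_swap], fun v hv hv' => hz v b hv hb hv' ⟨_, he, hbe⟩⟩
      · obtain ⟨e, he⟩ : 𝓔.Nonempty := Finset.card_pos.1 (by omega)
        induction e with | _ c b
        exact ⟨c, b, he, fun v hv hv' => absurd ⟨v, hv, hv'⟩ h⟩
    have hbc : b ≠ c := by rintro rfl; exact hd _ hcb (by simp)
    have htc : 1 ≤ t c := by
      by_contra h
      exact hbc (hcb' c (by omega) ⟨_, hcb, by simp⟩).symm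
    rw [← Finset.insert_erase hcb]
    have key : ∀ v, t v + (if v = b then 1 else 0) - (if v = c then 1 else 0) = 0 →
        (∃ e ∈ 𝓔.erase s(c, b), v ∈ e) → v = c := by
      rintro v hv ⟨e, he, hve⟩
      by_contra hvc
      rw [if_neg hvc] at hv
      have := hcb' v (by omega) ⟨e, Finset.mem_of_mem_erase he, hve⟩
      rw [if_pos this] at hv
      omega
    refine Solvable.insert_edge
      (t' := fun v => t v + (if v = b then 1 else 0) - (if v = c then 1 else 0))
      (ih _ _ (by rw [Finset.card_erase_of_mem hcb]; omega)
        (fun e he => hd e (Finset.mem_of_mem_erase he)) ?_ ?_) hbc (by simp) ?_ ?_ ?_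
    · intro v
      have h1 := ht v
      rw [← Finset.insert_erase hcb, Finset.filter_insert] at h1
      by_cases hvb : v = b
      · subst hvb
        simp [hbc] at h1 ⊢
        convert h1 using 1
        omega
      · by_cases hvc : v = c
        · subst hvc
          simp [hbc.symm] at h1 ⊢
          rw [Nat.even_iff] at h1 ⊢
          omega
        · simpa [hvb, hvc] using h1
    · intro u v hu hv hu' hv'
      rw [key u hu hu', key v hv hv']
    · intro v hv
      by_contra h
      have := key v (by omega) ⟨_, hv, by simp⟩
      subst this
      exact hd _ (Finset.mem_of_mem_erase hv) (by simp)
    · simp [hbc]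
    · intro v
      by_cases hvc : v = c
      · subst hvc; simp [hbc.symm]; omega
      · simp [hvc]

theorem Solvable.union_image {𝓔 : Finset (Sym2 V)} {t : V → ℕ} (h : Solvable 𝓔 t) (S : Finset V)
    (c : V → V) (hinj : Set.InjOn c S) (hcS : ∀ b ∈ S, c b ∉ S) (ht : ∀ b ∈ S, 1 ≤ t b)
    (hb : ∀ b ∈ S, s(c b, b) ∉ 𝓔) (hn : ∀ b ∈ S, ∀ v, s(c b, v) ∈ 𝓔 → 1 ≤ t v ∧ v ∉ S) :
    Solvable (𝓔 ∪ S.image fun b => s(c b, b))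
      (fun v => t v - (if v ∈ S then 1 else 0) + (if v ∈ S.image c then 1 else 0)) := by
  induction S using Finset.induction_on with
  | empty => simpa using h
  | insert b S hbS ih =>
    have ih := ih (hinj.mono (by simp)) (fun x hx hx' => hcS x (by simp [hx]) (by simp [hx']))
      (fun x hx => ht x (by simp [hx])) (fun x hx => hb x (by simp [hx]))
      (fun x hx v hv => ⟨(hn x (by simp [hx]) v hv).1,
        fun h => (hn x (by simp [hx]) v hv).2 (by simp [h])⟩)
    have hcb : c b ∉ S := fun h => hcS b (by simp) (by simp [h])
    have hcb' : c b ≠ b := fun h => hcS b (by simp) (by simp [h])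
    have hcx : ∀ x ∈ S, c x ≠ b := fun x hx h => hcS x (by simp [hx]) (by simp [h])
    have hcc : ∀ x ∈ S, c x ≠ c b := fun x hx h => hbS <| by
      rwa [← hinj (by simp [hx]) (by simp) h]
    rw [Finset.image_insert, Finset.union_insert]
    refine ih.insert_edge hcb'.symm ?_ ?_ ?_ ?_
    · simp only [Finset.mem_union, Finset.mem_image, not_or, not_exists, not_and]
      refine ⟨hb b (by simp), fun x hx h => ?_⟩
      rcases Sym2.eq_iff.1 h with h | h
      · exact hcc x hx h.1
      · exact hcx x hx h.1
    · intro v hv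
      rw [Finset.mem_union, Finset.mem_image] at hv
      rcases hv with hv | ⟨x, hx, h⟩
      · have := hn b (by simp) v hv
        have h2 : v ∉ S := fun h => this.2 (by simp [h])
        simp only [h2, if_false]; omega
      · rcases Sym2.eq_iff.1 h with h | h
        · exact absurd h.1 (hcc x hx)
        · exact absurd (h.2 ▸ hx) hcb
    · have := ht b (by simp)
      simp only [hbS, if_false]; omega
    · intro v
      have h1 : b ∉ S.image c := by simpa using hcx
      have h2 : c b ∉ S.image c := by simpa using hcc
      have := ht b (by simp)
      by_cases hv : v = b
      · subst hv
        simp only [Finset.mem_insert_self, Finset.image_insert, Finset.mem_insert, hcb'.symm, h1, hbS]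
        simp; omega
      · by_cases hv' : v = c b
        · subst hv'
          simp [hcb, hcb', h2]
        · simp only [Finset.mem_insert, Finset.image_insert, hv, hv', false_or, if_false]
end Solve

section Merge
variable {V : Type*}

theorem eq_of_mem_of_pathEdges {β : Type*} (s : V → β) {L : List V}
    (h : ∀ u v, s(u, v) ∈ pathEdges L → s u = s v) : ∀ u ∈ L, ∀ v ∈ L, s u = s v := by
  suffices H : ∀ a l, L = a :: l → ∀ u ∈ L, s u = s a by
    intro u hu v hv
    obtain ⟨a, l, rfl⟩ := List.exists_cons_of_ne_nil (List.ne_nil_of_mem hu)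
    rw [H a l rfl u hu, H a l rfl v hv]
  induction L with
  | nil => simp
  | cons x L ih =>
    intro a l hl u hu
    obtain ⟨rfl, rfl⟩ := List.cons_eq_cons.1 hl
    rcases List.mem_cons.1 hu with rfl | hu
    · rfl
    · obtain ⟨b, l, rfl⟩ := List.exists_cons_of_ne_nil (List.ne_nil_of_mem hu)
      rw [ih (fun u v huv => h u v (Multiset.mem_cons_of_mem huv)) b l rfl u hu]
      exact (h _ _ (Multiset.mem_cons_self _ _)).symm

theorem exists_cons_perm {L : List V} {a : V} (h : a ∈ pathEnds L) :
    ∃ l, (a :: l).Perm L ∧ pathEdges (a :: l) = pathEdges L ∧ pathEnds (a :: l) = pathEnds L := by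
  rcases exists_orient h with h | h
  · obtain ⟨l, rfl⟩ := List.head?_eq_some_iff.1 h
    exact ⟨l, .refl _, rfl, rfl⟩
  · obtain ⟨l, hl⟩ := List.head?_eq_some_iff.1 h
    exact ⟨l, hl ▸ List.reverse_perm _, by rw [← hl, pathEdges_reverse],
      by rw [← hl, pathEnds_reverse]⟩

theorem exists_extend {L : List V} {a b : V} (hL : L.Nodup) (ha : a ∈ pathEnds L) (hb : b ∉ L) :
    ∃ M : List V, M.Nodup ∧ pathEdges M = s(a, b) ::ₘ pathEdges L ∧
      pathEnds M + {a} = pathEnds L + {b} := by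
  obtain ⟨l, h1, h2, h3⟩ := exists_cons_perm ha
  refine ⟨b :: a :: l, List.nodup_cons.2 ⟨fun h => hb (h1.mem_iff.1 h), h1.nodup_iff.2 hL⟩, ?_, ?_⟩
  · rw [pathEdges, h2, Sym2.eq_swap]
  · rw [← h3]
    simp [pathEnds, -Multiset.singleton_add]
    ac_rfl

theorem exists_join {L R : List V} {a b : V} (hL : L.Nodup) (hR : R.Nodup) (ha : a ∈ pathEnds L)
    (hb : b ∈ pathEnds R) (hd : List.Disjoint L R) :
    ∃ M : List V, M.Nodup ∧ pathEdges M = s(a, b) ::ₘ (pathEdges L + pathEdges R) ∧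
      pathEnds M + {a} + {b} = pathEnds L + pathEnds R := by
  obtain ⟨l, h1, h2, h3⟩ := exists_cons_perm ha
  obtain ⟨r, h4, h5, h6⟩ := exists_cons_perm hb
  refine ⟨(a :: l).reverse ++ b :: r, ?_, ?_, ?_⟩
  · rw [((List.reverse_perm _).trans h1).append h4 |>.nodup_iff]
    exact hL.append hR hd
  · rw [← h2, ← h5, ← pathEdges_reverse (a :: l)]
    simp only [List.reverse_cons, List.append_assoc, List.cons_append, List.nil_append]
    rw [pathEdges_append_append]
  · rw [← h3, ← h6, pathEnds, List.getLast?_append_of_ne_nil _ (by simp), List.head?_append]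
    simp only [pathEnds, List.head?_reverse, List.getLast?_cons, List.head?_cons]
    simp [-Multiset.singleton_add]
    ac_rfl

variable [DecidableEq V]

theorem sum_count_le_card (U : Finset V) (M : Multiset V) : ∑ x ∈ U, M.count x ≤ M.card := by
  induction M using Multiset.induction_on with
  | empty => simp
  | cons a M ih =>
    simp only [Multiset.count_cons, Finset.sum_add_distrib, Multiset.card_cons]
    rw [Finset.sum_ite_eq']
    split_ifs <;> omega

theorem exists_injective_ends {K : Type*} [DecidableEq K] {N : ℕ} (D : Fin N → List V)
    (A : K → Finset V) (hA : ∀ k l, k ≠ l → Disjoint (A k) (A l))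
    (h2 : ∀ k, 2 ≤ ∑ x ∈ A k, (∑ i, pathEnds (D i)).count x) :
    ∃ f : K → Fin N, f.Injective ∧ ∀ k, ∃ x ∈ A k, x ∈ pathEnds (D (f k)) := by
  classical
  let B : K → Finset (Fin N) := fun k => {i | ∃ x ∈ A k, x ∈ pathEnds (D i)}
  obtain ⟨f, hf, hfB⟩ := (Finset.all_card_le_biUnion_card_iff_exists_injective B).1 (by
    intro T
    have h1 : 2 * T.card ≤ ∑ x ∈ T.biUnion A, (∑ i, pathEnds (D i)).count x := by
      rw [Finset.sum_biUnion fun k _ l _ h => hA k l h, mul_comm]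
      exact Finset.card_nsmul_le_sum T _ 2 fun k _ => h2 k
    have h3 : ∑ x ∈ T.biUnion A, (∑ i, pathEnds (D i)).count x ≤ ∑ i ∈ T.biUnion B, 2 := by
      simp only [Multiset.count_sum']
      rw [Finset.sum_comm, ← Finset.sum_subset (Finset.subset_univ (T.biUnion B))]
      · refine Finset.sum_le_sum fun i _ => (sum_count_le_card _ _).trans ?_
        by_cases h : D i = []
        · simp [h, pathEnds]
        · rw [card_pathEnds h]
      · intro i _ hi
        refine Finset.sum_eq_zero fun x hx => Multiset.count_eq_zero.2 fun hx' => hi ?_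
        obtain ⟨k, hk, hxk⟩ := Finset.mem_biUnion.1 hx
        exact Finset.mem_biUnion.2 ⟨k, hk, by simp only [B, Finset.mem_filter_univ]; exact ⟨x, hxk, hx'⟩⟩
    simp only [Finset.sum_const, smul_eq_mul] at h3
    omega)
  exact ⟨f, hf, fun k => by simpa [B] using hfB k⟩

theorem exists_merge {J β : Type*} [Fintype J] [DecidableEq J] {N : ℕ} (D : Fin N → List V)
    (hD : ∀ i, (D i).Nodup) (s : V → β) (hs : ∀ i, ∀ u ∈ D i, ∀ v ∈ D i, s u = s v)
    (a b : J → V) (ha : a.Injective) (hb : b.Injective) (hab : ∀ j k, a j ≠ b k)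
    (hsab : ∀ j, s (a j) ≠ s (b j)) (X : Finset J)
    (hX : ∀ j ∈ X, 2 ≤ (∑ i, pathEnds (D i)).count (a j) ∧ 2 ≤ (∑ i, pathEnds (D i)).count (b j))
    (hX' : ∀ j ∉ X, 2 ≤ (∑ i, pathEnds (D i)).count (a j) + (∑ i, pathEnds (D i)).count (b j)) :
    ∃ D' : Fin N → List V, (∀ i, (D' i).Nodup) ∧
      ∑ i, pathEdges (D' i) = ∑ i, pathEdges (D i) + ∑ j, {s(a j, b j)} ∧
      ∑ i, pathEnds (D i) ≤ ∑ i, pathEnds (D' i) + ∑ j, ({a j} + {b j}) ∧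
      (∑ i, pathEnds (D' i)).card + 2 * X.card = (∑ i, pathEnds (D i)).card := by
  let A : J ⊕ X → Finset V :=
    Sum.elim (fun j => if j ∈ X then {a j} else {a j, b j}) (fun j => {b j})
  obtain ⟨f, hf, hfA⟩ := exists_injective_ends D A (by
    have hA : ∀ j, ∀ x ∈ A (.inl j), x = a j ∨ x = b j ∧ j ∉ X := by
      intro j x hx
      simp only [A, Sum.elim_inl] at hx
      split_ifs at hx with h
      · simp at hx; simp [hx]
      · simpa [h] using hx
    intro k l hkl
    rw [Finset.disjoint_left]
    intro x hk hl
    rcases k with k | k <;> rcases l with l | l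
    · have hkl : k ≠ l := fun h => hkl (by rw [h])
      rcases hA k x hk with rfl | ⟨rfl, h⟩ <;> rcases hA l _ hl with h' | ⟨h', h''⟩
      · exact hkl (ha h')
      · exact hab _ _ h'
      · exact hab _ _ h'.symm
      · exact hkl (hb h')
    · simp only [A, Sum.elim_inr, Finset.mem_singleton] at hl
      subst hl
      rcases hA k _ hk with h | ⟨h, h'⟩
      · exact hab _ _ h.symm
      · exact h' (hb h ▸ l.2)
    · simp only [A, Sum.elim_inr, Finset.mem_singleton] at hk
      subst hk
      rcases hA l _ hl with h | ⟨h, h'⟩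
      · exact hab _ _ h.symm
      · exact h' (hb h ▸ k.2)
    · simp only [A, Sum.elim_inr, Finset.mem_singleton] at hk hl
      exact hkl (by rw [Subtype.ext (hb (hk.symm.trans hl))])) (by
    rintro (j | j)
    · by_cases h : j ∈ X
      · simp only [A, Sum.elim_inl, h, if_true, Finset.sum_singleton]
        exact (hX j h).1
      · simp only [A, Sum.elim_inl, h, if_false]
        rw [Finset.sum_pair (hab j j)]
        exact hX' j h
    · simp only [A, Sum.elim_inr, Finset.sum_singleton]
      exact (hX j j.2).2)
  suffices H : ∀ S : Finset J, ∃ D' : Fin N → List V, (∀ i, (D' i).Nodup) ∧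
      ∑ i, pathEdges (D' i) = ∑ i, pathEdges (D i) + ∑ j ∈ S, {s(a j, b j)} ∧
      ∑ i, pathEnds (D i) ≤ ∑ i, pathEnds (D' i) + ∑ j ∈ S, ({a j} + {b j}) ∧
      (∑ i, pathEnds (D' i)).card + 2 * (X ∩ S).card = (∑ i, pathEnds (D i)).card ∧
      ∀ i, (∀ j ∈ S, i ≠ f (.inl j) ∧ ∀ h : j ∈ X, i ≠ f (.inr ⟨j, h⟩)) → D' i = D i by
    obtain ⟨D', h1, h2, h3, h4, -⟩ := H Finset.univ
    exact ⟨D', h1, h2, h3, by simpa using h4⟩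
  intro S
  induction S using Finset.induction_on with
  | empty => exact ⟨D, hD, by simp, by simp, by simp, fun _ _ => rfl⟩
  | insert j S hjS ih =>
    obtain ⟨D₁, hD₁, hE, hT, hc, hi⟩ := ih
    have hl : D₁ (f (.inl j)) = D (f (.inl j)) := hi _ fun k hk =>
      ⟨fun h => hjS (by rwa [Sum.inl.inj (hf h)]), fun _ h => nomatch hf h⟩
    have hr : ∀ h : j ∈ X, D₁ (f (.inr ⟨j, h⟩)) = D (f (.inr ⟨j, h⟩)) := fun h => hi _ fun k hk =>
      ⟨fun h => (nomatch hf h), fun h' h => hjS (by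
        have := Sum.inr.inj (hf h); rw [Subtype.mk.injEq] at this; rwa [this])⟩
    have hmem : ∀ {L : List V} {x}, x ∈ pathEnds L → x ∈ L := by
      intro L x hx
      obtain ⟨l, hl, -⟩ := exists_cons_perm hx
      exact hl.mem_iff.1 (by simp)
    obtain ⟨x, hx, hxe⟩ := hfA (.inl j)
    rw [← hl] at hxe
    by_cases hj : j ∈ X
    · simp only [A, Sum.elim_inl, hj, if_true, Finset.mem_singleton] at hx
      subst hx
      obtain ⟨y, hy, hye⟩ := hfA (.inr ⟨j, hj⟩)
      rw [← hr hj] at hye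
      simp only [A, Sum.elim_inr, Finset.mem_singleton] at hy
      subst hy
      have hne : f (.inl j) ≠ f (.inr ⟨j, hj⟩) := fun h => nomatch hf h
      obtain ⟨M, hM, hME, hMT⟩ := exists_join (hD₁ _) (hD₁ _) hxe hye (by
        intro v hv hv'
        refine hsab j ?_
        rw [hl] at hv hxe
        rw [hr hj] at hv' hye
        rw [hs _ _ (hmem hxe) _ hv, hs _ _ (hmem hye) _ hv'])
      refine ⟨Function.update (Function.update D₁ (f (.inl j)) M) (f (.inr ⟨j, hj⟩)) [],
        ?_, ?_, ?_, ?_, ?_⟩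
      · intro i
        rw [Function.update_apply, Function.update_apply]
        split_ifs
        · simp
        · exact hM
        · exact hD₁ i
      · have h1 := sum_update_add pathEdges D₁ (f (.inl j)) M
        have h2 := sum_update_add pathEdges (Function.update D₁ (f (.inl j)) M)
          (f (.inr ⟨j, hj⟩)) []
        rw [Function.update_of_ne hne.symm] at h2
        rw [Finset.sum_insert hjS]
        simp only [pathEdges, add_zero] at h2
        apply add_right_cancel (b := pathEdges (D₁ (f (.inr ⟨j, hj⟩))) +
          pathEdges (D₁ (f (.inl j))))
        rw [← add_assoc, h2, h1, hE, hME, ← Multiset.singleton_add]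
        ac_rfl
      all_goals
        have h1 := sum_update_add pathEnds D₁ (f (.inl j)) M
        have h2 := sum_update_add pathEnds (Function.update D₁ (f (.inl j)) M)
          (f (.inr ⟨j, hj⟩)) []
        rw [Function.update_of_ne hne.symm] at h2
        rw [show pathEnds ([] : List V) = 0 from rfl, add_zero] at h2
        have h3 : ∑ i, pathEnds (Function.update (Function.update D₁ (f (.inl j)) M)
            (f (.inr ⟨j, hj⟩)) [] i) + ({a j} + {b j}) = ∑ i, pathEnds (D₁ i) := by
          apply add_right_cancel (b := pathEnds (D₁ (f (.inl j))) +
            pathEnds (D₁ (f (.inr ⟨j, hj⟩))))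
          generalize ∑ i, pathEnds (Function.update (Function.update D₁ (f (.inl j)) M)
            (f (.inr ⟨j, hj⟩)) [] i) = T at h2 ⊢
          rw [← h2] at h1
          calc _ = (T + pathEnds (D₁ (f (.inr ⟨j, hj⟩))) + pathEnds (D₁ (f (.inl j)))) +
                {a j} + {b j} := by ac_rfl
            _ = ∑ i, pathEnds (D₁ i) + (pathEnds M + {a j} + {b j}) := by rw [h1]; ac_rfl
            _ = _ := by rw [hMT]
      · rw [Finset.sum_insert hjS, ← add_assoc, h3]
        exact hT
      · rw [Finset.inter_insert_of_mem hj, Finset.card_insert_of_notMem (by simp [hjS])]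
        have := congrArg Multiset.card h3
        simp only [Multiset.card_add, Multiset.card_singleton] at this
        omega
      · intro i hi'
        have := hi' j (by simp)
        rw [Function.update_of_ne (this.2 hj), Function.update_of_ne this.1]
        exact hi i fun k hk => hi' k (by simp [hk])
    · obtain ⟨y, hxy, hsxy, hE'⟩ : ∃ y, ({x} + {y} : Multiset V) = {a j} + {b j} ∧ s x ≠ s y ∧
          s(x, y) = s(a j, b j) := by
        simp only [A, Sum.elim_inl, hj, if_false, Finset.mem_insert, Finset.mem_singleton] at hx
        rcases hx with rfl | rfl
        · exact ⟨_, rfl, hsab j, rfl⟩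
        · exact ⟨_, add_comm _ _, (hsab j).symm, Sym2.eq_swap⟩
      obtain ⟨M, hM, hME, hMT⟩ := exists_extend (hD₁ _) hxe (b := y) (by
        intro hy
        rw [hl] at hxe hy
        exact hsxy (hs _ _ (hmem hxe) _ hy))
      refine ⟨Function.update D₁ (f (.inl j)) M, ?_, ?_, ?_, ?_, ?_⟩
      · intro i
        rw [Function.update_apply]
        split_ifs
        · exact hM
        · exact hD₁ i
      · have h1 := sum_update_add pathEdges D₁ (f (.inl j)) M
        rw [Finset.sum_insert hjS]
        apply add_right_cancel (b := pathEdges (D₁ (f (.inl j))))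
        rw [h1, hE, hME, ← Multiset.singleton_add, hE']
        ac_rfl
      all_goals
        have h1 := sum_update_add pathEnds D₁ (f (.inl j)) M
        have h3 : ∑ i, pathEnds (Function.update D₁ (f (.inl j)) M i) + {x} =
            ∑ i, pathEnds (D₁ i) + {y} := by
          apply add_right_cancel (b := pathEnds (D₁ (f (.inl j))))
          generalize ∑ i, pathEnds (Function.update D₁ (f (.inl j)) M i) = T at h1 ⊢
          calc _ = (T + pathEnds (D₁ (f (.inl j)))) + {x} := by ac_rfl
            _ = ∑ i, pathEnds (D₁ i) + (pathEnds M + {x}) := by rw [h1]; ac_rfl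
            _ = _ := by rw [hMT]; ac_rfl
      · rw [Finset.sum_insert hjS, ← add_assoc, ← hxy, ← add_assoc, h3]
        refine hT.trans ?_
        gcongr
        rw [add_assoc]
        exact le_add_of_nonneg_right zero_le
      · rw [Finset.inter_insert_of_notMem hj]
        have := congrArg Multiset.card h3
        simp only [Multiset.card_add, Multiset.card_singleton] at this
        omega
      · intro i hi'
        rw [Function.update_of_ne (hi' j (by simp)).1]
        exact hi i fun k hk => hi' k (by simp [hk])
end Merge

section Convert
variable {V : Type*}

theorem SimpleGraph.exists_walk_support_eq (Γ : SimpleGraph V) (l : List V) : ∀ a : V,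
    (∀ e ∈ pathEdges (a :: l), e ∈ Γ.edgeSet) →
    ∃ (v : V) (w : Γ.Walk a v), w.support = a :: l ∧ (w.edges : Multiset (Sym2 V)) =
      pathEdges (a :: l) := by
  induction l with
  | nil => exact fun a _ => ⟨a, .nil, by simp [pathEdges]⟩
  | cons b l ih =>
    intro a h
    obtain ⟨v, w, h1, h2⟩ := ih b fun e he => h e (Multiset.mem_cons_of_mem he)
    have hab : Γ.Adj a b := h s(a, b) (Multiset.mem_cons_self _ _)
    refine ⟨v, .cons hab w, by simp [h1], ?_⟩
    rw [pathEdges, ← h2, Walk.edges_cons]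
    rfl

theorem SimpleGraph.two_mul_pathNumber_le (Γ : SimpleGraph V) {N : ℕ} (D : Fin N → List V)
    (hD : ∀ i, (D i).Nodup) (hE : (∑ i, pathEdges (D i)).Nodup)
    (hΓ : ∀ e, e ∈ ∑ i, pathEdges (D i) ↔ e ∈ Γ.edgeSet) :
    2 * Γ.pathNumber ≤ (∑ i, pathEnds (D i)).card := by
  classical
  have hw : ∀ i : {i // D i ≠ []}, ∃ p : (Σ u v : V, Γ.Walk u v), p.2.2.IsPath ∧
      (p.2.2.edges : Multiset (Sym2 V)) = pathEdges (D i) := by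
    rintro ⟨i, hi⟩
    obtain ⟨a, l, hal⟩ := List.exists_cons_of_ne_nil hi
    obtain ⟨v, w, h1, h2⟩ := Γ.exists_walk_support_eq l a fun e he => (hΓ e).1 <|
      Multiset.mem_sum.2 ⟨i, Finset.mem_univ _, by rwa [hal]⟩
    exact ⟨⟨a, v, w⟩, Walk.IsPath.mk' (by rw [h1, ← hal]; exact hD i), by rw [h2, hal]⟩
  choose p hp hpE using hw
  have hmem : ∀ i e, e ∈ (p i).2.2.edges ↔ e ∈ pathEdges (D i) := fun i e => by
    rw [← hpE, Multiset.mem_coe]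
  have hle : Γ.pathNumber ≤ Fintype.card {i // D i ≠ []} := by
    refine Nat.sInf_le ⟨Finset.univ.toList.map p, ⟨?_, ?_, ?_⟩, by simp⟩
    · intro q hq
      obtain ⟨i, -, rfl⟩ := List.mem_map.1 hq
      exact hp i
    · rw [List.pairwise_map]
      refine (Finset.nodup_toList _).imp fun {i j} hij e he he' => ?_
      rw [hmem] at he he'
      have h1 := Multiset.nodup_iff_count_le_one.1 hE e
      rw [Multiset.count_sum'] at h1
      have hij' : (i : Fin N) ≠ j := fun h => hij (Subtype.ext h)
      have h2 := Finset.sum_le_sum_of_subset (f := fun k => (pathEdges (D k)).count e)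
        (Finset.subset_univ {(i : Fin N), (j : Fin N)})
      rw [Finset.sum_pair hij'] at h2
      have h3 := Multiset.one_le_count_iff_mem.2 he
      have h4 := Multiset.one_le_count_iff_mem.2 he'
      omega
    · intro e he
      obtain ⟨i, -, hi⟩ := Multiset.mem_sum.1 ((hΓ e).2 he)
      have : D i ≠ [] := by rintro h; simp [h, pathEdges] at hi
      exact ⟨p ⟨i, this⟩, by simp, (hmem _ _).2 hi⟩
  have hcard : (∑ i, pathEnds (D i)).card = ∑ i, if D i ≠ [] then 2 else 0 := by
    rw [Multiset.card_sum]
    refine Finset.sum_congr rfl fun i _ => ?_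
    split_ifs with h
    · exact card_pathEnds h
    · rw [not_not] at h
      rw [h]; rfl
  rw [hcard, Finset.sum_ite, Finset.sum_const, Finset.sum_const_zero, ← Fintype.card_subtype]
  simp only [smul_eq_mul]
  omega
end Convert

section Product
open Classical

/-- The layers, from the sixth on, whose parity is that of the last layer of `Fin m`. -/
def IsSecond (m i : ℕ) : Prop := 5 ≤ i ∧ (i + m) % 2 = 1

/-- The oriented vertical edges kept in a column of the base graph; `p` tells whether the column
sits over a vertex of even degree. -/
def layerRel (m : ℕ) (p : Prop) (i j : ℕ) : Prop :=
  p ∧ (i = 1 ∧ j = 2 ∨ i = 0 ∧ j = 2 ∨ i = 2 ∧ j = 3 ∨ IsSecond m j ∧ i + 1 = j) ∨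
  ¬ p ∧ (i = 0 ∧ j = 1 ∨ i = 2 ∧ j = 3 ∨ i = 0 ∧ j = 2 ∨ i = 1 ∧ j = 3)

theorem card_filter_layerRel (m : ℕ) (hm : 4 ≤ m) (p : Prop) (i : Fin m) :
    (Finset.univ.filter fun j : Fin m => layerRel m p i j ∨ layerRel m p j i).card % 2 =
      if p ∧ ¬ (i.val = 4 ∧ m % 2 = 1) then 1 else 0 := by
  have aux : ∀ (s : Finset (Fin m)), (∀ j : Fin m, j ∈ s ↔ (layerRel m p i j ∨ layerRel m p j i)) →
      (Finset.univ.filter fun j : Fin m => layerRel m p i j ∨ layerRel m p j i) = s := by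
    intro s hs; ext j; rw [hs]; simp
  obtain ⟨i, hi⟩ := i
  have h01 : (⟨0, by omega⟩ : Fin m) ≠ ⟨1, by omega⟩ := by simp
  have h03 : (⟨0, by omega⟩ : Fin m) ≠ ⟨3, by omega⟩ := by simp
  have h12 : (⟨1, by omega⟩ : Fin m) ≠ ⟨2, by omega⟩ := by simp
  have h13 : (⟨1, by omega⟩ : Fin m) ≠ ⟨3, by omega⟩ := by simp
  by_cases hp : p
  · simp only [layerRel, hp, true_and, not_true, false_and, or_false, IsSecond] at aux ⊢
    by_cases h2 : i = 2
    · subst h2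
      rw [aux {⟨0, by omega⟩, ⟨1, by omega⟩, ⟨3, by omega⟩}]
      · rw [Finset.card_insert_of_notMem (by simp), Finset.card_pair h13]
        simp
      · rintro ⟨j, hj⟩; simp [Fin.ext_iff]; omega
    by_cases h4 : i < 4
    · rw [aux {⟨2, by omega⟩}]
      · have : i ≠ 4 := by omega
        simp [this]
      · rintro ⟨j, hj⟩; simp [Fin.ext_iff]; omega
    by_cases h5 : i = 4 ∧ m % 2 = 1
    · rw [aux ∅]
      · simp [h5]
      · rintro ⟨j, hj⟩; simp; omega
    by_cases h6 : 5 ≤ i ∧ (i + m) % 2 = 1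
    · rw [aux {⟨i - 1, by omega⟩}]
      · simp [h5]
      · rintro ⟨j, hj⟩; simp [Fin.ext_iff]; omega
    · rw [aux {⟨i + 1, by omega⟩}]
      · simp [h5]
      · rintro ⟨j, hj⟩; simp [Fin.ext_iff]; omega
  · simp only [layerRel, hp, not_false_eq_true, true_and, false_and, false_or, if_false] at aux ⊢
    by_cases h4 : 4 ≤ i
    · rw [aux ∅]
      · simp
      · rintro ⟨j, hj⟩; simp; omega
    by_cases h2 : i = 0 ∨ i = 3
    · rw [aux {⟨1, by omega⟩, ⟨2, by omega⟩}]
      · rw [Finset.card_pair h12]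
      · rintro ⟨j, hj⟩; simp [Fin.ext_iff]; omega
    · rw [aux {⟨0, by omega⟩, ⟨3, by omega⟩}]
      · rw [Finset.card_pair h03]
      · rintro ⟨j, hj⟩; simp [Fin.ext_iff]; omega

variable {W : Type*}

/-- The spanning subgraph of the product decomposed first. -/
def baseGraph (m : ℕ) (H : SimpleGraph W) (p : W → Prop) : SimpleGraph (Fin m × W) where
  Adj u v := u.1 = v.1 ∧ H.Adj u.2 v.2 ∨
    u.2 = v.2 ∧ (layerRel m (p u.2) u.1 v.1 ∨ layerRel m (p u.2) v.1 u.1)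
  symm := ⟨by
    rintro u v (h | h)
    · exact .inl ⟨h.1.symm, h.2.symm⟩
    · exact .inr ⟨h.1.symm, h.1 ▸ h.2.symm⟩⟩
  loopless := ⟨by
    rintro u (h | h)
    · exact H.loopless.irrefl _ h.2
    · simp only [layerRel] at h; omega⟩

theorem degree_baseGraph [Fintype W] (m : ℕ) (H : SimpleGraph W) (p : W → Prop) (v : Fin m × W) :
    (baseGraph m H p).degree v = H.degree v.2 +
      (Finset.univ.filter fun j : Fin m =>
        layerRel m (p v.2) v.1 j ∨ layerRel m (p v.2) j v.1).card := by
  obtain ⟨i, x⟩ := v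
  have : (baseGraph m H p).neighborFinset (i, x) =
      (H.neighborFinset x).image (fun y => (i, y)) ∪
      (Finset.univ.filter fun j : Fin m =>
        layerRel m (p x) i j ∨ layerRel m (p x) j i).image (fun j => (j, x)) := by
    ext ⟨j, y⟩
    simp only [mem_neighborFinset, Finset.mem_union, Finset.mem_image, Prod.mk.injEq,
      Finset.mem_filter_univ]
    simp only [baseGraph]
    constructor
    · rintro (⟨h, h'⟩ | ⟨h, h'⟩)
      · exact .inl ⟨y, h', h, rfl⟩
      · exact .inr ⟨j, h', rfl, h⟩
    · rintro (⟨y, h', h, rfl⟩ | ⟨y, h', rfl, h⟩)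
      · exact .inl ⟨h, h'⟩
      · exact .inr ⟨h, h'⟩
  rw [← card_neighborFinset_eq_degree, this, Finset.card_union_of_disjoint,
    Finset.card_image_of_injective _ (Prod.mk_right_injective i),
    Finset.card_image_of_injective _ (Prod.mk_left_injective x), card_neighborFinset_eq_degree]
  rw [Finset.disjoint_left]
  rintro ⟨j, y⟩ h h'
  obtain ⟨z, hz, h⟩ := Finset.mem_image.1 h
  obtain ⟨k, -, h'⟩ := Finset.mem_image.1 h'
  rw [← h', Prod.mk.injEq] at h
  rw [h.2] at hz
  simp at hz

theorem solvable_baseGraph [Fintype W] (m : ℕ) (hm : 4 ≤ m) (H : SimpleGraph W) :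
    Solvable (baseGraph m H fun x => Even (H.degree x)).edgeFinset
      (fun v => 1 + if v.1.val = 4 ∧ Even (H.degree v.2) ∧ m % 2 = 1 then 1 else 0) := by
  refine solvable_of_even _ _ _ rfl (fun e he => ?_) (fun v => ?_) (fun u v h => by omega)
  · exact not_isDiag_of_mem_edgeFinset he
  · rw [← incidenceFinset_eq_filter, card_incidenceFinset_eq_degree, degree_baseGraph]
    have h1 := card_filter_layerRel m hm (Even (H.degree v.2)) v.1
    generalize (Finset.univ.filter fun j : Fin m => layerRel m (Even (H.degree v.2)) v.1 j ∨
      layerRel m (Even (H.degree v.2)) j v.1).card = d at h1 ⊢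
    generalize H.degree v.2 = k at h1 ⊢
    simp only [Nat.even_iff] at h1 ⊢
    split_ifs at h1 ⊢ <;> omega
end Product

theorem sum_sub_add_image {V : Type*} [Fintype V] [DecidableEq V] (t : V → ℕ) (S : Finset V)
    (c : V → V) (hinj : Set.InjOn c S) (ht : ∀ b ∈ S, 1 ≤ t b) :
    ∑ v, (t v - (if v ∈ S then 1 else 0) + (if v ∈ S.image c then 1 else 0)) = ∑ v, t v := by
  have h : ∑ v, (t v - (if v ∈ S then 1 else 0)) + ∑ v, (if v ∈ S then 1 else 0) = ∑ v, t v := by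
    rw [← Finset.sum_add_distrib]
    refine Finset.sum_congr rfl fun v _ => ?_
    split_ifs with hv
    · have := ht v hv; omega
    · rfl
  rw [Finset.sum_add_distrib, ← h]
  have hc := Finset.card_image_of_injOn hinj
  rw [Finset.sum_boole, Finset.sum_boole, Finset.filter_univ_mem, Finset.filter_univ_mem, hc]

theorem mk_mem_image_mk {V : Type*} [DecidableEq V] {S : Finset V} {c : V → V} {u v : V} :
    s(u, v) ∈ S.image (fun b => s(c b, b)) ↔ (v ∈ S ∧ u = c v) ∨ (u ∈ S ∧ v = c u) := by
  rw [Finset.mem_image]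
  constructor
  · rintro ⟨b, hb, h⟩
    rcases Sym2.eq_iff.1 h with ⟨rfl, rfl⟩ | ⟨rfl, rfl⟩
    · exact .inl ⟨hb, rfl⟩
    · exact .inr ⟨hb, rfl⟩
  · rintro (⟨h, rfl⟩ | ⟨h, rfl⟩)
    · exact ⟨v, h, rfl⟩
    · exact ⟨u, h, Sym2.eq_swap⟩

section Product
open Classical

/-- The oriented vertical edges inside a group of layers. -/
def groupRel (m i j : ℕ) : Prop :=
  i + 1 = j ∧ (j < 4 ∨ IsSecond m j) ∨ i = 0 ∧ j = 2 ∨ i = 1 ∧ j = 3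

theorem layerRel_or_iff_groupRel (m i j : ℕ) (p : Prop) :
    (((layerRel m p i j ∨ layerRel m p j i) ∨
      (j = 0 ∧ p ∨ ¬p ∧ (j = 2 ∨ IsSecond m j)) ∧ i = (if j = 0 then 1 else j - 1) ∨
      (i = 0 ∧ p ∨ ¬p ∧ (i = 2 ∨ IsSecond m i)) ∧ j = (if i = 0 then 1 else i - 1)) ∨
      (j = 1 ∧ p) ∧ i = 3 ∨ (i = 1 ∧ p) ∧ j = 3) ↔ groupRel m i j ∨ groupRel m j i := by
  have h5 : ∀ k, IsSecond m k → 5 ≤ k := fun k h => h.1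
  have hi := h5 i
  have hj := h5 j
  clear h5
  unfold layerRel groupRel
  generalize IsSecond m i = a at *
  generalize IsSecond m j = b at *
  by_cases hp : p
  · simp only [hp, and_true, true_and, not_true, false_and, or_false]
    clear hp p 
    constructor
    · rintro (((h | h) | h | h) | h | h)
      · grind
      · grind
      · split_ifs at h <;> omega
      · split_ifs at h <;> omega
      · omega
      · omega
    · rintro ((⟨h, h' | h'⟩ | h | h) | ⟨h, h' | h'⟩ | h | h) 
      · have : i = 0 ∨ i = 1 ∨ i = 2 := by omega
        rcases this with rfl | rfl | rfl <;> simp_all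
      · grind
      · grind
      · grind
      · have : j = 0 ∨ j = 1 ∨ j = 2 := by omega
        rcases this with rfl | rfl | rfl <;> simp_all
      · grind
      · grind
      · grind
  · simp only [hp, and_false, not_false_eq_true, true_and, false_and, or_false, false_or]
    constructor
    · grind
    · rintro ((⟨h, h' | h'⟩ | h | h) | ⟨h, h' | h'⟩ | h | h)
      · have : i = 0 ∨ i = 1 ∨ i = 2 := by omega
        rcases this with rfl | rfl | rfl <;> simp_all
        omega
      · grind
      · grind
      · grind
      · have : j = 0 ∨ j = 1 ∨ j = 2 := by omega
        rcases this with rfl | rfl | rfl <;> simp_all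
        omega
      · grind
      · grind
      · grind

theorem exists_solvable_groups {W : Type*} [Fintype W] (m : ℕ) (hm : 4 ≤ m) (H : SimpleGraph W)
    (p : W → Prop) (hp : p = fun x => Even (H.degree x)) :
    ∃ (𝓔 : Finset (Sym2 (Fin m × W))) (t : Fin m × W → ℕ), Solvable 𝓔 t ∧
      (∀ u v, s(u, v) ∈ 𝓔 ↔ u.1 = v.1 ∧ H.Adj u.2 v.2 ∨
        u.2 = v.2 ∧ (groupRel m u.1 v.1 ∨ groupRel m v.1 u.1)) ∧
      (∀ v, v.1.val = 3 → 1 ≤ t v ∧ (p v.2 → 2 ≤ t v)) ∧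
      (∀ v, 4 ≤ v.1.val → p v.2 → 1 ≤ t v) ∧
      (∀ v, v.1.val = 4 → m % 2 = 1 → 1 ≤ t v ∧ (p v.2 → 2 ≤ t v)) ∧
      (∀ v, 4 ≤ v.1.val → v.1.val + 1 < m → IsSecond m (v.1 + 1) → ¬ p v.2 → 2 ≤ t v) ∧
      ∑ v, t v =
        ∑ v : Fin m × W, (1 + if v.1.val = 4 ∧ p v.2 ∧ m % 2 = 1 then 1 else 0) := by
  have h0 := solvable_baseGraph m hm H
  rw [← hp] at h0
  have h0' : Solvable (baseGraph m H p).edgeFinset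
      (fun v => 1 + if v.1.val = 4 ∧ p v.2 ∧ m % 2 = 1 then 1 else 0) := by
    convert h0 using 3
    simp [hp]
  clear h0
  set t₀ : Fin m × W → ℕ := fun v => 1 + if v.1.val = 4 ∧ p v.2 ∧ m % 2 = 1 then 1 else 0 with ht₀
  have ht1 : ∀ v, 1 ≤ t₀ v := fun v => by simp [ht₀]
  have hE0 : ∀ u v : Fin m × W, s(u, v) ∈ (baseGraph m H p).edgeFinset ↔
      (u.1.val = v.1.val ∧ H.Adj u.2 v.2 ∨
        u.2 = v.2 ∧ (layerRel m (p u.2) u.1 v.1 ∨ layerRel m (p u.2) v.1 u.1)) := by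
    intro u v
    rw [mem_edgeFinset, mem_edgeSet]
    simp only [baseGraph, Fin.ext_iff]
  let S₁ : Finset (Fin m × W) := Finset.univ.filter fun v =>
    v.1.val = 0 ∧ p v.2 ∨ ¬ p v.2 ∧ (v.1.val = 2 ∨ IsSecond m v.1)
  let c₁ : Fin m × W → Fin m × W := fun v =>
    (⟨if v.1.val = 0 then 1 else v.1 - 1, by split_ifs <;> omega⟩, v.2)
  let S₂ : Finset (Fin m × W) := Finset.univ.filter fun v => v.1.val = 1 ∧ p v.2
  let c₂ : Fin m × W → Fin m × W := fun v => (⟨3, by omega⟩, v.2)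
  have hS₁ : ∀ v, v ∈ S₁ ↔ v.1.val = 0 ∧ p v.2 ∨ ¬ p v.2 ∧ (v.1.val = 2 ∨ IsSecond m v.1) := by
    simp [S₁]
  have hS₂ : ∀ v, v ∈ S₂ ↔ v.1.val = 1 ∧ p v.2 := by simp [S₂]
  have hext : ∀ u v : Fin m × W, u = v ↔ u.1.val = v.1.val ∧ u.2 = v.2 := fun u v => by
    rw [Prod.ext_iff, Fin.ext_iff]
  have hc₁1 : ∀ v, (c₁ v).1.val = if v.1.val = 0 then 1 else v.1.val - 1 := fun v => rfl
  have hc₁2 : ∀ v, (c₁ v).2 = v.2 := fun v => rfl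
  have hc₂1 : ∀ v, (c₂ v).1.val = 3 := fun v => rfl
  have hc₂2 : ∀ v, (c₂ v).2 = v.2 := fun v => rfl
  have hinj₁ : Set.InjOn c₁ S₁ := by
    intro u hu v hv h
    rw [Finset.mem_coe, hS₁] at hu hv
    rw [hext, hc₁1, hc₁1, hc₁2, hc₁2] at h
    rw [hext]
    obtain ⟨h, h'⟩ := h
    refine ⟨?_, h'⟩
    rw [h'] at hu
    clear * - hu hv h
    grind [IsSecond]
  have hinj₂ : Set.InjOn c₂ S₂ := by
    intro u hu v hv h
    rw [Finset.mem_coe, hS₂] at hu hv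
    rw [hext, hc₂2, hc₂2] at h
    rw [hext]
    exact ⟨by omega, h.2⟩
  have h1 := h0'.union_image S₁ c₁ hinj₁ (by
    intro b hb hb'
    rw [hS₁] at hb hb'
    rw [hc₁1, hc₁2] at hb'
    clear * - hb hb' hm
    grind [IsSecond]) (fun b _ => ht1 b) (by
    intro b hb hb'
    rw [hS₁] at hb
    rw [hE0, hc₁1, hc₁2] at hb'
    clear * - hb hb' hm
    grind [IsSecond, layerRel]) (by
    intro b hb v hv
    refine ⟨ht1 v, fun hv' => ?_⟩
    rw [hS₁] at hb hv'
    rw [hE0, hc₁1, hc₁2] at hv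
    clear * - hb hv hv' hm
    split_ifs at hv <;> grind [IsSecond, layerRel])
  set t₁ : Fin m × W → ℕ := fun v =>
    t₀ v - (if v ∈ S₁ then 1 else 0) + (if v ∈ S₁.image c₁ then 1 else 0) with ht₁
  have ht₁0 : ∀ b ∉ S₁, 1 ≤ t₁ b := by
    intro b hb
    simp only [ht₁, hb, if_false]
    have := ht1 b
    omega
  have htS₂ : ∀ b ∈ S₂, 1 ≤ t₁ b := by
    intro b hb
    refine ht₁0 b fun hb' => ?_
    rw [hS₂] at hb
    rw [hS₁] at hb'
    grind [IsSecond]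
  have hE1 : ∀ u v : Fin m × W, (s(u, v) ∈ (baseGraph m H p).edgeFinset ∪
      S₁.image fun b => s(c₁ b, b)) ↔
      (u.1.val = v.1.val ∧ H.Adj u.2 v.2 ∨ u.2 = v.2 ∧
        (layerRel m (p u.2) u.1 v.1 ∨ layerRel m (p u.2) v.1 u.1)) ∨
      v ∈ S₁ ∧ u.1.val = (c₁ v).1.val ∧ u.2 = v.2 ∨
      u ∈ S₁ ∧ v.1.val = (c₁ u).1.val ∧ v.2 = u.2 := by
    intro u v
    rw [Finset.mem_union, mk_mem_image_mk, hE0, hext, hext]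
  have h2 := h1.union_image S₂ c₂ hinj₂ (by
    intro b hb hb'
    rw [hS₂, hc₂1] at hb'
    omega) htS₂ (by
    intro b hb hb'
    rw [hS₂] at hb
    rw [hE1, hS₁, hS₁, hc₁1, hc₁1, hc₂1, hc₂2] at hb'
    clear * - hb hb' hm
    grind [IsSecond, layerRel]) (by
    intro b hb v hv
    rw [hS₂] at hb
    rw [hE1, hS₁, hS₁, hc₁1, hc₁1, hc₂1, hc₂2] at hv
    refine ⟨ht₁0 v fun h => ?_, fun h => ?_⟩
    · rw [hS₁] at h
      clear * - hb hv h hm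
      grind [IsSecond, layerRel]
    · rw [hS₂] at h
      clear * - hb hv h hm
      grind [IsSecond, layerRel])
  have hlow : ∀ v, v ∉ S₁ → v ∉ S₂ → t₀ v + (if v ∈ S₁.image c₁ then 1 else 0) +
      (if v ∈ S₂.image c₂ then 1 else 0) ≤
      t₁ v - (if v ∈ S₂ then 1 else 0) + (if v ∈ S₂.image c₂ then 1 else 0) := by
    intro v hv1 hv2
    simp only [ht₁, hv1, hv2, if_false]
    omega
  refine ⟨_, _, h2, ?_, ?_, ?_, ?_, ?_, ?_⟩
  · intro u v
    rw [Finset.mem_union, hE1, mk_mem_image_mk, hext, hext, hS₁, hS₁, hS₂, hS₂, hc₁1, hc₁1, hc₂1,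
      hc₂2 u, hc₂2 v, Fin.ext_iff]
    clear * - hm
    obtain ⟨⟨i, hi⟩, x⟩ := u
    obtain ⟨⟨j, hj⟩, y⟩ := v
    dsimp only
    by_cases hxy : x = y
    · subst hxy
      have := layerRel_or_iff_groupRel m i j (p x)
      simpa only [SimpleGraph.irrefl, and_false, false_or, true_and, and_true] using this
    · simp [hxy, Ne.symm hxy]
  · intro v hv
    have hv2 : v ∉ S₂ := fun h => by rw [hS₂] at h; omega
    have hv1 : v ∉ S₁ := fun h => by
      rw [hS₁] at h
      clear * - h hv
      grind [IsSecond]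
    have hlow := hlow v hv1 hv2
    have := ht1 v
    refine ⟨by omega, fun hpv => ?_⟩
    have hmem : v ∈ S₂.image c₂ := Finset.mem_image.2 ⟨(⟨1, by omega⟩, v.2), by simp [hS₂, hpv],
      by rw [hext, hc₂1]; simp [hc₂2, hv]⟩
    simp only [if_pos hmem] at hlow ⊢
    omega
  · intro v hv hpv
    have hv2 : v ∉ S₂ := fun h => by rw [hS₂] at h; omega
    have hv1 : v ∉ S₁ := fun h => by
      rw [hS₁] at h
      clear * - h hv hpv
      grind [IsSecond]
    have hlow := hlow v hv1 hv2
    have := ht1 v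
    omega
  · intro v hv hmo
    have hv2 : v ∉ S₂ := fun h => by rw [hS₂] at h; omega
    have hv1 : v ∉ S₁ := fun h => by
      rw [hS₁] at h
      clear * - h hv
      grind [IsSecond]
    have hlow := hlow v hv1 hv2
    have := ht1 v
    refine ⟨by omega, fun hpv => ?_⟩
    have : t₀ v = 2 := by simp [ht₀, hv, hpv, hmo]
    omega
  · intro v hv hvm hs hpv
    have hv2 : v ∉ S₂ := fun h => by rw [hS₂] at h; omega
    have hv1 : v ∉ S₁ := fun h => by
      rw [hS₁] at h
      clear * - h hv hs
      grind [IsSecond]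
    have hlow := hlow v hv1 hv2
    have := ht1 v
    have hmem : v ∈ S₁.image c₁ := Finset.mem_image.2 ⟨(⟨v.1 + 1, hvm⟩, v.2), by
      rw [hS₁]; exact .inr ⟨hpv, .inr hs⟩, by rw [hext, hc₁1]; simp [hc₁2]⟩
    rw [if_pos hmem] at hlow
    omega
  · rw [sum_sub_add_image t₁ S₂ c₂ hinj₂ htS₂, sum_sub_add_image t₀ S₁ c₁ hinj₁ fun b _ => ht1 b]
end Product

section Solve
variable {V : Type*} [Fintype V] [DecidableEq V]

theorem Solvable.merge {J β : Type*} [Fintype J] [DecidableEq J] {𝓔 : Finset (Sym2 V)} {t : V → ℕ}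
    (h : Solvable 𝓔 t) (s : V → β) (hs : ∀ u v, s(u, v) ∈ 𝓔 → s u = s v)
    (a b : J → V) (ha : a.Injective) (hb : b.Injective) (hab : ∀ j k, a j ≠ b k)
    (hsab : ∀ j, s (a j) ≠ s (b j)) (X : Finset J) (hX : ∀ j ∈ X, 2 ≤ t (a j) ∧ 2 ≤ t (b j))
    (hX' : ∀ j ∉ X, 2 ≤ t (a j) + t (b j)) :
    ∃ t', Solvable (𝓔 ∪ Finset.univ.image fun j => s(a j, b j)) t' ∧
      (∀ v, t v ≤ t' v + ∑ j, ((if v = a j then 1 else 0) + if v = b j then 1 else 0)) ∧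
      ∑ v, t' v + 2 * X.card = ∑ v, t v := by
  obtain ⟨N, D, hD, hE, ht⟩ := h
  have hs' : ∀ i, ∀ u ∈ D i, ∀ v ∈ D i, s u = s v := fun i =>
    eq_of_mem_of_pathEdges s fun u v huv => hs u v <| by
      rw [← Finset.mem_val, ← hE]
      exact Multiset.mem_sum.2 ⟨i, Finset.mem_univ _, huv⟩
  obtain ⟨D', hD', hE', hT, hcard⟩ := exists_merge D hD s hs' a b ha hb hab hsab X
    (by simpa only [ht] using hX) (by simpa only [ht] using hX')
  have hcount : ∀ T : Multiset V, ∑ v, T.count v = T.card := fun T =>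
    Multiset.sum_count_eq_card fun v _ => Finset.mem_univ v
  refine ⟨fun v => (∑ i, pathEnds (D' i)).count v, ⟨N, D', hD', ?_, fun _ => rfl⟩, fun v => ?_, ?_⟩
  · have hinj : Function.Injective fun j => s(a j, b j) := by
      intro j k hjk
      rcases Sym2.eq_iff.1 hjk with h | h
      · exact ha h.1
      · exact absurd h.1 (hab j k)
    have hdisj : Disjoint 𝓔 (Finset.univ.image fun j => s(a j, b j)) := by
      rw [Finset.disjoint_right]
      intro e he he'
      obtain ⟨j, -, rfl⟩ := Finset.mem_image.1 he
      exact hsab j (hs _ _ he')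
    rw [hE', hE, ← Finset.disjUnion_eq_union _ _ hdisj, Finset.disjUnion_val,
      Finset.image_val_of_injOn hinj.injOn, ← Multiset.sum_map_singleton
        (Multiset.map (fun j => s(a j, b j)) _), Multiset.map_map]
    rfl
  · have := Multiset.count_le_of_le v hT
    rw [ht, Multiset.count_add] at this
    simpa only [Multiset.count_sum', Multiset.count_add, Multiset.count_singleton] using this
  · rw [hcount, hcard, ← hcount]
    simp only [ht]

theorem Solvable.two_mul_pathNumber_le {𝓔 : Finset (Sym2 V)} {t : V → ℕ} (h : Solvable 𝓔 t)
    (Γ : SimpleGraph V) (hΓ : ∀ u v, s(u, v) ∈ 𝓔 ↔ Γ.Adj u v) :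
    2 * Γ.pathNumber ≤ ∑ v, t v := by
  obtain ⟨N, D, hD, hE, ht⟩ := h
  have hcount := Multiset.sum_count_eq_card (s := Finset.univ) (m := ∑ i, pathEnds (D i))
    fun v _ => Finset.mem_univ v
  simp only [ht] at hcount
  rw [hcount]
  refine Γ.two_mul_pathNumber_le D hD (hE ▸ 𝓔.nodup) fun e => ?_
  rw [hE, Finset.mem_val]
  induction e with
  | h u v => exact hΓ u v
end Solve

section Product
open Classical

theorem exists_solvable_product {W : Type*} [Fintype W] (m : ℕ) (hm : 4 ≤ m)
    (H : SimpleGraph W) :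
    ∃ (𝓔 : Finset (Sym2 (Fin m × W))) (t : Fin m × W → ℕ), Solvable 𝓔 t ∧
      (∀ u v, s(u, v) ∈ 𝓔 ↔ u.1 = v.1 ∧ H.Adj u.2 v.2 ∨
        u.2 = v.2 ∧ ((u.1.val + 1 = v.1 ∨ u.1.val = 0 ∧ v.1.val = 2 ∨ u.1.val = 1 ∧ v.1.val = 3) ∨
          (v.1.val + 1 = u.1 ∨ v.1.val = 0 ∧ u.1.val = 2 ∨ v.1.val = 1 ∧ u.1.val = 3))) ∧
      ∑ v, t v ≤ m * Fintype.card W := by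
  obtain ⟨p, hp⟩ : ∃ p : W → Prop, p = fun x => Even (H.degree x) := ⟨_, rfl⟩
  obtain ⟨𝓔, t, h, hE, h3, h4, h4', h5, hsum⟩ := exists_solvable_groups m hm H p hp
  have hext : ∀ u v : Fin m × W, u = v ↔ u.1.val = v.1.val ∧ u.2 = v.2 := fun u v => by
    rw [Prod.ext_iff, Fin.ext_iff]
  let a₁ : {v : Fin m × W // v.1.val = 4} → Fin m × W := fun v => (⟨3, by omega⟩, v.1.2)
  have ha₁ : ∀ v, (a₁ v).1.val = 3 ∧ (a₁ v).2 = v.1.2 := fun v => ⟨rfl, rfl⟩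
  obtain ⟨t₁, h₁, ht₁, hsum₁⟩ := h.merge
    (fun v => if v.1.val < 4 then 0 else (v.1.val + m % 2) / 2) (by
      intro u v huv
      rw [hE, Fin.ext_iff] at huv
      unfold groupRel IsSecond at huv
      clear * - huv
      split_ifs <;> omega) a₁ Subtype.val
    (by
      intro u v huv
      have h1 := u.2
      have h2 := v.2
      have := ha₁ u
      rw [huv, (ha₁ v).2] at this
      exact Subtype.ext ((hext _ _).2 ⟨by omega, this.2.symm⟩))
    Subtype.val_injective
    (by
      intro u v huv
      have h1 := v.2
      have h2 := (ha₁ u).1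
      rw [huv] at h2
      omega)
    (by
      intro v
      have h1 := v.2
      simp only [(ha₁ v).1, h1]
      simp
      omega)
    ((Finset.univ.filter fun v : Fin m × W => v.1.val = 4 ∧ p v.2 ∧ m % 2 = 1).subtype _)
    (by
      intro v hv
      obtain ⟨-, -, hpv, hmo⟩ := Finset.mem_filter.1 (Finset.mem_subtype.1 hv)
      refine ⟨(h3 _ (ha₁ v).1).2 ?_, (h4' _ v.2 hmo).2 hpv⟩
      rwa [(ha₁ v).2])
    (by
      intro v hv
      rw [Finset.mem_subtype, Finset.mem_filter] at hv
      have h1 := v.2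
      have h2 := h3 _ (ha₁ v).1
      rw [(ha₁ v).2] at h2
      have hlt := v.1.1.isLt
      by_cases hmo : m % 2 = 1
      · have := (h4' _ v.2 hmo).1
        omega
      · by_cases hpv : p v.1.2
        · have := h2.2 hpv
          omega
        · have := h5 v.1 h1.ge (by omega) (by unfold IsSecond; omega) hpv
          omega)
  have hcard : ((Finset.univ.filter fun v : Fin m × W => v.1.val = 4 ∧ p v.2 ∧ m % 2 = 1).subtype
      fun v => v.1.val = 4).card =
      ∑ v : Fin m × W, if v.1.val = 4 ∧ p v.2 ∧ m % 2 = 1 then 1 else 0 := by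
    rw [Finset.card_subtype, Finset.filter_filter, Finset.sum_boole, Nat.cast_id]
    congr 1
    ext v
    simp only [Finset.mem_filter]
    tauto
  rw [hcard, hsum, Finset.sum_add_distrib, Finset.sum_const, Finset.card_univ, Fintype.card_prod,
    Fintype.card_fin, smul_eq_mul, mul_one] at hsum₁
  have hE₁ : ∀ u v : Fin m × W, (s(u, v) ∈ 𝓔 ∪ Finset.univ.image fun j => s(a₁ j, j.1)) ↔
      u.1 = v.1 ∧ H.Adj u.2 v.2 ∨ u.2 = v.2 ∧
        ((groupRel m u.1 v.1 ∨ u.1.val = 3 ∧ v.1.val = 4) ∨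
          (groupRel m v.1 u.1 ∨ v.1.val = 3 ∧ u.1.val = 4)) := by
    intro u v
    have : s(u, v) ∈ Finset.univ.image (fun j => s(a₁ j, j.1)) ↔
        v.1.val = 4 ∧ u.1.val = 3 ∧ u.2 = v.2 ∨ u.1.val = 4 ∧ v.1.val = 3 ∧ v.2 = u.2 := by
      rw [Finset.mem_image]
      constructor
      · rintro ⟨j, -, hj⟩
        rcases Sym2.eq_iff.1 hj with ⟨rfl, rfl⟩ | ⟨rfl, rfl⟩
        · exact .inl ⟨j.2, ha₁ j⟩
        · exact .inr ⟨j.2, ha₁ j⟩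
      · rintro (⟨h1, h2, h3⟩ | ⟨h1, h2, h3⟩)
        · exact ⟨⟨v, h1⟩, Finset.mem_univ _, Sym2.eq_iff.2
            (.inl ⟨(hext _ _).2 ⟨h2.symm, h3.symm⟩, rfl⟩)⟩
        · exact ⟨⟨u, h1⟩, Finset.mem_univ _, Sym2.eq_iff.2
            (.inr ⟨(hext _ _).2 ⟨h2.symm, h3.symm⟩, rfl⟩)⟩
    rw [Finset.mem_union, hE, this]
    clear * -
    grind
  have hlow₁ : ∀ v : Fin m × W, 4 ≤ v.1.val → t v ≤ t₁ v + if v.1.val = 4 then 1 else 0 := by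
    intro v hv
    refine (ht₁ v).trans (Nat.add_le_add_left ?_ _)
    have hva : ∀ j, v ≠ a₁ j := fun j hj => by
      have := (ha₁ j).1
      rw [← hj] at this
      omega
    simp only [hva, if_false, zero_add]
    rw [Finset.sum_boole, Nat.cast_id]
    split_ifs with hv4
    · refine Finset.card_le_one.2 fun i hi j hj => Subtype.ext ?_
      rw [← (Finset.mem_filter.1 hi).2, ← (Finset.mem_filter.1 hj).2]
    · rw [Nat.le_zero, Finset.card_eq_zero, Finset.filter_eq_empty_iff]
      intro j _ hj
      exact hv4 (hj ▸ j.2)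
  let a₂ : {v : Fin m × W // 5 ≤ v.1.val ∧ ¬ IsSecond m v.1} → Fin m × W :=
    fun v => (⟨v.1.1 - 1, by omega⟩, v.1.2)
  have ha₂ : ∀ v, (a₂ v).1.val = v.1.1.val - 1 ∧ (a₂ v).2 = v.1.2 := fun v => ⟨rfl, rfl⟩
  obtain ⟨t₂, h₂, -, hsum₂⟩ := h₁.merge
    (fun v => if v.1.val < 4 then 2 else (v.1.val + m % 2) / 2) (by
      intro u v huv
      rw [hE₁, Fin.ext_iff] at huv
      unfold groupRel IsSecond at huv
      clear * - huv
      split_ifs <;> omega) a₂ Subtype.val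
    (by
      intro u v huv
      have h1 := u.2.1
      have h2 := v.2.1
      have := ha₂ u
      rw [huv, (ha₂ v).1, (ha₂ v).2] at this
      exact Subtype.ext ((hext _ _).2 ⟨by omega, this.2.symm⟩))
    Subtype.val_injective
    (by
      intro u v huv
      have h1 := u.2
      have h2 := v.2
      have h3 := (ha₂ u).1
      rw [huv] at h3
      unfold IsSecond at h1 h2
      omega)
    (by
      intro v
      have h1 := v.2
      unfold IsSecond at h1
      simp only [(ha₂ v).1]
      split_ifs <;> omega)
    ∅ (by simp)
    (by
      intro v _
      obtain ⟨h1, h2⟩ := v.2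
      have hlt := v.1.1.isLt
      have ha := ha₂ v
      have hv1 := hlow₁ v.1 (by omega)
      have hv2 := hlow₁ (a₂ v) (by omega)
      rw [if_neg (by omega)] at hv1
      by_cases hpv : p v.1.2
      · have h6 := h4 v.1 (by omega) hpv
        have h7 := h4 (a₂ v) (by omega) (by rwa [ha.2])
        have h8 := h4' (a₂ v)
        rw [ha.2] at h8
        unfold IsSecond at h2
        split_ifs at hv2 with h9
        · have := (h8 h9 (by omega)).2 hpv
          omega
        · omega
      · unfold IsSecond at h2
        have := h5 v.1 (by omega) (by omega) (by unfold IsSecond; omega) hpv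
        omega)
  refine ⟨_, t₂, h₂, ?_, ?_⟩
  · intro u v
    have : s(u, v) ∈ Finset.univ.image (fun j => s(a₂ j, j.1)) ↔
        (5 ≤ v.1.val ∧ ¬ IsSecond m v.1) ∧ u.1.val = v.1 - 1 ∧ u.2 = v.2 ∨
        (5 ≤ u.1.val ∧ ¬ IsSecond m u.1) ∧ v.1.val = u.1 - 1 ∧ v.2 = u.2 := by
      rw [Finset.mem_image]
      constructor
      · rintro ⟨j, -, hj⟩
        rcases Sym2.eq_iff.1 hj with ⟨rfl, rfl⟩ | ⟨rfl, rfl⟩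
        · exact .inl ⟨j.2, ha₂ j⟩
        · exact .inr ⟨j.2, ha₂ j⟩
      · rintro (⟨h1, h2, h3⟩ | ⟨h1, h2, h3⟩)
        · exact ⟨⟨v, h1⟩, Finset.mem_univ _, Sym2.eq_iff.2
            (.inl ⟨(hext _ _).2 ⟨h2.symm, h3.symm⟩, rfl⟩)⟩
        · exact ⟨⟨u, h1⟩, Finset.mem_univ _, Sym2.eq_iff.2
            (.inr ⟨(hext _ _).2 ⟨h2.symm, h3.symm⟩, rfl⟩)⟩
    rw [Finset.mem_union, hE₁, this]
    have h5 : ∀ k, IsSecond m k → 5 ≤ k := fun k hk => hk.1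
    have hu := h5 u.1
    have hv := h5 v.1
    clear * - hu hv
    unfold groupRel
    generalize IsSecond m u.1 = A at *
    generalize IsSecond m v.1 = B at *
    obtain ⟨⟨i, hi⟩, x⟩ := u
    obtain ⟨⟨j, hj⟩, y⟩ := v
    dsimp only at *
    by_cases hxy : x = y
    · subst hxy
      by_cases hA : A <;> by_cases hB : B <;>
        simp only [hA, hB, true_imp_iff, SimpleGraph.irrefl, and_false, false_or, true_and,
          and_true, or_true, or_false, not_true, not_false_eq_true, false_and] at * <;> omega
    · simp [hxy, Ne.symm hxy]
  · rw [Finset.card_empty] at hsum₂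
    omega
end Product

/-- Gallai's bound for the product of a member of the family `ℱ`
(path `u₁⋯u_m` plus edges `u₁u₃` and `u₂u₄`) with a connected graph `H`. -/
theorem pathNumber_familyF_boxProd_le {W : Type*} [Fintype W] (m : ℕ) (hm : 4 ≤ m)
    (H : SimpleGraph W) (hH : H.Connected) :
    2 * ((pathGraph m ⊔ fromEdgeSet
        {s((⟨0, by omega⟩ : Fin m), (⟨2, by omega⟩ : Fin m)),
         s((⟨1, by omega⟩ : Fin m), (⟨3, by omega⟩ : Fin m))}) □ H).pathNumber ≤
      m * Fintype.card W := by
  classical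
  obtain ⟨𝓔, t, h, hE, hsum⟩ := exists_solvable_product m hm H
  refine (Solvable.two_mul_pathNumber_le (t := t) (𝓔 := 𝓔) (by convert h) _ fun u v => ?_).trans hsum
  rw [hE, boxProd_adj, sup_adj, pathGraph_adj, fromEdgeSet_adj]
  simp only [Set.mem_insert_iff, Set.mem_singleton_iff, Sym2.eq_iff, Fin.ext_iff]
  by_cases h2 : u.2 = v.2
  · simp only [h2, SimpleGraph.irrefl, and_false, false_or, true_and, and_true, false_and, or_false]
    omega
  · simp only [h2, false_and, and_false, or_false, false_or]
    tauto
end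

section
/- For every tree T, p(T) = n_o(T)/2, i.e., the minimum number of paths in a path decomposition of T equals half the number of vertices of odd degree in T. -/
open SimpleGraph

/-- `n_o(G)`: the number of vertices of `G` of odd degree. -/
def SimpleGraph.oddCount {V : Type*} [Fintype V] (G : SimpleGraph V)
    [DecidableRel G.Adj] : ℕ :=
  (Finset.univ.filter fun v => Odd (G.degree v)).card

namespace SimpleGraph

variable {V : Type*} {G : SimpleGraph V}

/-- The degree of a vertex, counted along any enumeration of the edges without repetition. -/
lemma degree_eq_countP [Fintype V] [DecidableEq V] [DecidableRel G.Adj] {l : List (Sym2 V)}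
    (hl : l.Nodup) (h : ∀ e, e ∈ l ↔ e ∈ G.edgeSet) (x : V) :
    G.degree x = l.countP fun e => x ∈ e := by
  rw [← card_incidenceFinset_eq_degree, incidenceFinset_eq_filter, List.countP_eq_length_filter,
    ← List.toFinset_card_of_nodup (hl.filter _)]
  congr 1
  ext e
  simp [h]

/-- Removing the edges of a trail lowers the degree of a vertex by the number of
trail edges at that vertex. -/
lemma Walk.IsTrail.degree_deleteEdges_add_countP [Fintype V] [DecidableEq V] [DecidableRel G.Adj]
    {u v : V} {p : G.Walk u v} (hp : p.IsTrail) [DecidableRel (G.deleteEdges p.edgeSet).Adj]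
    (x : V) :
    (G.deleteEdges p.edgeSet).degree x + p.edges.countP (fun e => x ∈ e) = G.degree x := by
  have hmem (e : Sym2 V) : e ∈ (G.deleteEdges p.edgeSet).edgeFinset.toList ↔
      e ∈ G.edgeSet ∧ e ∉ p.edges := by
    rw [Finset.mem_toList, mem_edgeFinset, edgeSet_deleteEdges]
    simp
  rw [degree_eq_countP (Finset.nodup_toList (G.deleteEdges p.edgeSet).edgeFinset)
    (fun e => by rw [Finset.mem_toList, mem_edgeFinset]) x, ← List.countP_append, eq_comm]
  refine degree_eq_countP ?_ ?_ x
  · exact (Finset.nodup_toList _).append hp.edges_nodup fun e he => ((hmem e).1 he).2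
  · intro e
    rw [List.mem_append, hmem]
    have := @p.edges_subset_edgeSet _ _ _ _ e
    tauto

/-- Some path of a path decomposition ends at each vertex of odd degree. -/
lemma IsPathDecomp.exists_eq_or_eq_of_odd_degree [Fintype V] [DecidableRel G.Adj]
    {P : List (Σ u v : V, G.Walk u v)} (hP : G.IsPathDecomp P) {x : V} (hx : Odd (G.degree x)) :
    ∃ p ∈ P, x = p.1 ∨ x = p.2.1 := by
  classical
  obtain ⟨hpath, hdisj, hcover⟩ := hP
  by_contra! hne
  have hnodup : (P.flatMap fun p => p.2.2.edges).Nodup :=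
    List.nodup_flatMap.2 ⟨fun p hp => (hpath p hp).isTrail.edges_nodup, hdisj.imp fun h _ => h _⟩
  have hmem (e : Sym2 V) : e ∈ (P.flatMap fun p => p.2.2.edges) ↔ e ∈ G.edgeSet := by
    rw [List.mem_flatMap]
    exact ⟨fun ⟨p, _, he⟩ => p.2.2.edges_subset_edgeSet he, hcover e⟩
  rw [degree_eq_countP hnodup hmem, List.countP_flatMap, ← Nat.not_even_iff_odd] at hx
  refine hx (even_iff_two_dvd.2 (List.dvd_sum fun n hn => ?_))
  obtain ⟨p, hp, rfl⟩ := List.mem_map.1 hn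
  exact even_iff_two_dvd.1 (((hpath p hp).isTrail.even_countP_edges_iff x).2 fun _ => hne p hp)

lemma IsPathDecomp.oddCount_le [Fintype V] [DecidableRel G.Adj]
    {P : List (Σ u v : V, G.Walk u v)} (hP : G.IsPathDecomp P) :
    G.oddCount ≤ 2 * P.length := by
  classical
  have hsub : (Finset.univ.filter fun v => Odd (G.degree v)) ⊆
      (P.map (fun p => p.1) ++ P.map (fun p => p.2.1)).toFinset := by
    intro x hx
    obtain ⟨p, hp, h⟩ := hP.exists_eq_or_eq_of_odd_degree (Finset.mem_filter.1 hx).2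
    rw [List.mem_toFinset, List.mem_append, List.mem_map, List.mem_map]
    exact h.imp (fun h => ⟨p, hp, h.symm⟩) fun h => ⟨p, hp, h.symm⟩
  calc G.oddCount ≤ _ := Finset.card_le_card hsub
    _ ≤ _ := List.toFinset_card_le _
    _ = 2 * P.length := by simp [two_mul]

/-- All edges at the initial vertex of a longest path of a forest lie on that path. -/
lemma IsAcyclic.mem_edges_of_forall_length_le (hG : G.IsAcyclic) {u v : V} {p : G.Walk u v}
    (hp : p.IsPath) (hmax : ∀ (u' v' : V) (q : G.Walk u' v'), q.IsPath → q.length ≤ p.length)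
    {w : V} (h : G.Adj u w) : s(u, w) ∈ p.edges := by
  by_contra hw
  have hq : (Walk.cons h.symm p).IsPath :=
    (hG.isPath_iff_isTrail _).2 (Walk.isTrail_cons _ _ |>.2 ⟨hp.isTrail, by rwa [Sym2.eq_swap]⟩)
  have := hmax _ _ _ hq
  simp at this

/-- A forest with an edge has a path joining distinct vertices that uses all edges at
either of its ends. -/
lemma IsAcyclic.exists_isPath_forall_adj_mem_edges [Finite V] (hG : G.IsAcyclic) (hne : G ≠ ⊥) :
    ∃ (u v : V) (p : G.Walk u v), p.IsPath ∧ u ≠ v ∧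
      (∀ w, G.Adj u w → s(u, w) ∈ p.edges) ∧ ∀ w, G.Adj v w → s(v, w) ∈ p.edges := by
  obtain ⟨a, b, hab⟩ := ne_bot_iff_exists_adj.1 hne
  have : Nonempty V := ⟨a⟩
  obtain ⟨u, v, p, hp, hmax⟩ := Walk.exists_isPath_forall_isPath_length_le_length G
  refine ⟨u, v, p, hp, ?_, fun w h => hG.mem_edges_of_forall_length_le hp hmax h, fun w h => ?_⟩
  · rintro rfl
    have := hmax _ _ _ (Walk.IsPath.of_adj hab)
    simp [Walk.isPath_iff_nil.1 hp |>.eq_nil] at this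
  · have := hG.mem_edges_of_forall_length_le hp.reverse (by simpa using hmax) h
    simpa using this

/-- Adding a path to a path decomposition of what remains after deleting its edges. -/
lemma IsPathDecomp.cons_map_mapLe {u v : V} {p : G.Walk u v} (hp : p.IsPath)
    {P : List (Σ u v : V, (G.deleteEdges p.edgeSet).Walk u v)}
    (hP : (G.deleteEdges p.edgeSet).IsPathDecomp P) :
    G.IsPathDecomp (⟨u, v, p⟩ ::
      P.map fun q => ⟨q.1, q.2.1, q.2.2.mapLe (G.deleteEdges_le p.edgeSet)⟩) := by
  obtain ⟨hpath, hdisj, hcover⟩ := hP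
  refine ⟨?_, ?_, fun e he => ?_⟩
  · simp only [List.forall_mem_cons, List.forall_mem_map]
    exact ⟨hp, fun q hq => (hpath q hq).mapLe _⟩
  · simp only [List.pairwise_cons, List.forall_mem_map, List.pairwise_map,
      Walk.edges_mapLe_eq_edges]
    refine ⟨fun q _ e he heq => ?_, hdisj⟩
    have := q.2.2.edges_subset_edgeSet heq
    rw [edgeSet_deleteEdges] at this
    exact this.2 he
  · by_cases h : e ∈ p.edges
    · exact ⟨_, List.mem_cons_self, h⟩
    · obtain ⟨q, hq, heq⟩ := hcover e (by rw [edgeSet_deleteEdges]; exact ⟨he, h⟩)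
      exact ⟨_, List.mem_cons_of_mem _ (List.mem_map_of_mem hq),
        by rwa [Walk.edges_mapLe_eq_edges]⟩

/-- Deleting a path that uses all edges at either of its distinct ends removes
exactly these ends from the vertices of odd degree. -/
lemma Walk.IsPath.oddCount_deleteEdges_add_two [Fintype V] [DecidableRel G.Adj]
    {u v : V} {p : G.Walk u v} (hp : p.IsPath) (huv : u ≠ v)
    (hu : ∀ w, G.Adj u w → s(u, w) ∈ p.edges) (hv : ∀ w, G.Adj v w → s(v, w) ∈ p.edges)
    [DecidableRel (G.deleteEdges p.edgeSet).Adj] :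
    (G.deleteEdges p.edgeSet).oddCount + 2 = G.oddCount := by
  classical
  have hdeg := hp.isTrail.degree_deleteEdges_add_countP
  have heven := hp.isTrail.even_countP_edges_iff
  have hzero {x : V} (hx : ∀ w, G.Adj x w → s(x, w) ∈ p.edges) :
      (G.deleteEdges p.edgeSet).degree x = 0 := by
    rw [degree_eq_zero]
    intro w hw
    rw [deleteEdges_adj] at hw
    exact hw.2 (hx w hw.1)
  have hset : (Finset.univ.filter fun x => Odd (G.degree x)) =
      (Finset.univ.filter fun x => Odd ((G.deleteEdges p.edgeSet).degree x)) ∪ {u, v} := by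
    ext x
    simp only [Finset.mem_filter, Finset.mem_univ, true_and, Finset.mem_union, Finset.mem_insert,
      Finset.mem_singleton]
    have hxd := hdeg x
    have hxe := heven x
    have := hzero hu
    have := hzero hv
    grind
  rw [oddCount, oddCount, hset, Finset.card_union_of_disjoint, Finset.card_pair huv]
  simp [hzero hu, hzero hv]

theorem IsAcyclic.exists_isPathDecomp [Fintype V] (hG : G.IsAcyclic) [DecidableRel G.Adj] :
    ∃ P, G.IsPathDecomp P ∧ 2 * P.length = G.oddCount := by
  classical
  induction hn : G.oddCount using Nat.strong_induction_on generalizing G with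
  | _ n ih =>
    by_cases hne : G = ⊥
    · subst hne hn
      exact ⟨[], by simp [IsPathDecomp], by simp [oddCount]⟩
    · obtain ⟨u, v, p, hp, huv, hu, hv⟩ := hG.exists_isPath_forall_adj_mem_edges hne
      have hcount := hp.oddCount_deleteEdges_add_two huv hu hv
      obtain ⟨P, hP, hlen⟩ := ih _ (by omega) (hG.anti (G.deleteEdges_le p.edgeSet)) rfl
      refine ⟨_, hP.cons_map_mapLe hp, ?_⟩
      rw [List.length_cons, List.length_map]
      omega

end SimpleGraph

/-- For every tree `T`, `p(T) = n_o(T)/2`. -/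
theorem pathNumber_isTree {V : Type*} [Fintype V] (T : SimpleGraph V)
    [DecidableRel T.Adj] (hT : T.IsTree) :
    2 * T.pathNumber = T.oddCount := by
  obtain ⟨P, hP, hlen⟩ := hT.isAcyclic.exists_isPathDecomp
  obtain ⟨Q, hQ, hQlen⟩ := Nat.sInf_mem (s := {k | ∃ P, T.IsPathDecomp P ∧ P.length = k})
    ⟨_, P, hP, rfl⟩
  refine le_antisymm ?_ ?_
  · rw [← hlen]
    exact Nat.mul_le_mul_left 2 (Nat.sInf_le ⟨P, hP, rfl⟩)
  · rw [pathNumber, ← hQlen]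
    exact hQ.oddCount_le
end
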